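/- arXiv:2105.15187 — 2 statements merged into one kernel-verified Lean document; each statement's English description precedes it below -/
import Mathlib

section
/- For all nonnegative real numbers a, b, c, d with a + b + c + d = 1, one has (b + d)(a + b) + (a + c)(c + d) ≥ (b + c)/2. -/
/-- Decoupling inequality (core of Claim `half`): for nonnegative reals
`a, b, c, d` summing to `1`, the independent-coupling disagreement probability
`(b + d)(a + b) + (a + c)(c + d)` is at least half of the joint disagreement
probability `b + c`. -/
theorem decoupling_inequality (a b c d : ℝ) (ha : 0 ≤ a) (hb : 0 ≤ b)
    (hc : 0 ≤ c) (hd : 0 ≤ d) (hsum : a + b + c + d = 1) :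
    (b + d) * (a + b) + (a + c) * (c + d) ≥ (b + c) / 2 := by
  have h : (b + c) / 2 = (b + c) * (a + b + c + d) / 2 := by rw [hsum, mul_one]
  rw [h]
  have h1 := mul_nonneg (add_nonneg ha hd) (add_nonneg hb hc)
  have h2 := mul_nonneg ha hd
  nlinarith [sq_nonneg (b - c)]
end

section
/- Let μ be a probability mass function on Bool × Bool, let μ₁ and μ₂ be its marginals (the pushforwards of μ under the first and second projections), and let ν be the product distribution of μ₁ and μ₂, i.e., ν assigns to each pair (x, y) the mass μ₁(x)·μ₂(y). Then the probability under ν of the event {(x, y) : x ≠ y} is at least one half of the probability under μ of the event {(x, y) : x ≠ y}. -/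
/-- Probabilistic formulation of Claim `half`: if `μ` is a probability mass
function on `Bool × Bool`, `μ₁`, `μ₂` are its marginals, and `ν` is the product
of `μ₁` and `μ₂`, then the `ν`-probability of disagreement is at least half of
the `μ`-probability of disagreement. -/
theorem indep_coupling_disagreement (μ : PMF (Bool × Bool))
    (μ₁ μ₂ : PMF Bool) (hμ₁ : μ₁ = μ.map Prod.fst) (hμ₂ : μ₂ = μ.map Prod.snd)
    (ν : PMF (Bool × Bool)) (hν : ∀ p : Bool × Bool, ν p = μ₁ p.1 * μ₂ p.2) :
    ν.toOuterMeasure {p : Bool × Bool | p.1 ≠ p.2} ≥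
      μ.toOuterMeasure {p : Bool × Bool | p.1 ≠ p.2} / 2 := by
  have key : ∀ κ : PMF (Bool × Bool), κ.toOuterMeasure {p : Bool × Bool | p.1 ≠ p.2}
      = κ (true, false) + κ (false, true) := by
    intro κ
    rw [PMF.toOuterMeasure_apply, tsum_fintype, Fintype.sum_prod_type]
    simp [Set.indicator]
  have hs : μ (true, true) + μ (true, false) + μ (false, true) + μ (false, false) = 1 := by
    have h := μ.tsum_coe
    rw [tsum_fintype, Fintype.sum_prod_type] at h
    simpa [add_assoc] using h
  have h1 : ∀ x, μ₁ x = μ (x, true) + μ (x, false) := by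
    intro x
    rw [hμ₁, PMF.map_apply, tsum_fintype, Fintype.sum_prod_type]
    cases x <;> simp
  have h2 : ∀ x, μ₂ x = μ (true, x) + μ (false, x) := by
    intro x
    rw [hμ₂, PMF.map_apply, tsum_fintype, Fintype.sum_prod_type]
    cases x <;> simp
  rw [key, key, hν, hν]
  simp only [h1, h2]
  have ha := μ.apply_ne_top (true, true)
  have hb := μ.apply_ne_top (true, false)
  have hc := μ.apply_ne_top (false, true)
  have hd := μ.apply_ne_top (false, false)
  generalize μ (true, true) = a at *
  generalize μ (true, false) = b at *
  generalize μ (false, true) = c at *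
  generalize μ (false, false) = d at *
  lift a to NNReal using ha
  lift b to NNReal using hb
  lift c to NNReal using hc
  lift d to NNReal using hd
  rw [ge_iff_le]
  apply ENNReal.div_le_of_le_mul
  norm_cast at hs ⊢
  have hs' : (a : ℝ) + b + c + d = 1 := by exact_mod_cast hs
  have hg : (b : ℝ) + c ≤ ((a + b) * (b + d) + (c + d) * (a + c)) * 2 := by
    have e : (b : ℝ) + c = (b + c) * (a + b + c + d) := by rw [hs', mul_one]
    rw [e]
    have p1 : 0 ≤ ((b : ℝ) + c) * (a + d) := by positivity
    have p2 : 0 ≤ (a : ℝ) * d := by positivity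
    nlinarith [sq_nonneg ((b : ℝ) - c)]
  exact_mod_cast hg
end
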